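/- Let 𝖧 be a real Hilbert space, for i ∈ {1,…,m} let 𝖠ᵢ : 𝖧 → 2^𝖧 be maximally monotone, let 𝖡 : 𝖧 → 𝖧 be monotone and χ-Lipschitzian, and suppose zer(Σᵢ 𝖠ᵢ + 𝖡) ≠ ∅. Let ω₁,…,ω_m ∈ (0,1] with Σᵢ ωᵢ = 1, let γ ∈ (0, 1/χ), let ε ∈ (0,1), let (λₙ) be a sequence in [ε, 1], and let (z_{1,0},…,z_{m,0}) ∈ 𝖧^m. Iterate, for every n ∈ ℕ: xₙ = Σⱼ ωⱼ z_{j,n}; for i = 1,…,m: r_{i,n} = z_{i,n} − γ 𝖡xₙ and p_{i,n} = J_{(γ/ωᵢ)𝖠ᵢ} r_{i,n}; qₙ = Σⱼ ωⱼ p_{j,n}; for i = 1,…,m: s_{i,n} = 2qₙ − p_{i,n} + z_{i,n} − xₙ, t_{i,n} = s_{i,n} − γ 𝖡qₙ, z_{i,n+1} = z_{i,n} + λₙ(t_{i,n} − r_{i,n}). Then (xₙ) converges weakly to some x̄ with 0 ∈ Σᵢ₌₁^m 𝖠ᵢ x̄ + 𝖡x̄, and x_{n+1} − xₙ → 0 in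 norm. -/

import Mathlib

/-!
Statement 11: Parallel splitting algorithm (Theorem 4.2) for finding a zero of
`Σᵢ Aᵢ + B`: weak convergence of `xₙ = Σⱼ ωⱼ z_{j,n}` to a zero.
The resolvent steps `p_{i,n} = J_{(γ/ωᵢ)Aᵢ} r_{i,n}` are encoded by the
characterizing membership `r_{i,n} - p_{i,n} ∈ (γ/ωᵢ) • Aᵢ (p_{i,n})`.
-/

open scoped Pointwise RealInnerProductSpace Topology
open Filter Finset

noncomputable section

variable {E : Type*} [NormedAddCommGroup E] [InnerProductSpace ℝ E] [CompleteSpace E]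
  {m : ℕ}

/-- A set-valued operator is monotone. -/
def MonotoneSV (A : E → Set E) : Prop :=
  ∀ ⦃x y u v : E⦄, u ∈ A x → v ∈ A y → 0 ≤ ⟪x - y, u - v⟫

/-- A set-valued operator is maximally monotone. -/
def MaxMonotone (A : E → Set E) : Prop :=
  MonotoneSV A ∧ ∀ x u : E, (∀ y v, v ∈ A y → 0 ≤ ⟪x - y, u - v⟫) → u ∈ A x

omit [CompleteSpace E] in
lemma MaxMonotone.smul {A : E → Set E} (hA : MaxMonotone A) {c : ℝ} (hc : 0 < c) :
    MaxMonotone (fun x => c • A x) := by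
  refine ⟨?_, ?_⟩
  · intro x y u v hu hv
    obtain ⟨u', hu', rfl⟩ := Set.mem_smul_set.1 hu
    obtain ⟨v', hv', rfl⟩ := Set.mem_smul_set.1 hv
    rw [← smul_sub, inner_smul_right]
    exact mul_nonneg hc.le (hA.1 hu' hv')
  · intro x u h
    rw [Set.mem_smul_set_iff_inv_smul_mem₀ hc.ne']
    refine hA.2 _ _ fun y v hv => ?_
    have h1 := h y (c • v) (Set.smul_mem_smul_set hv)
    have h2 : u - c • v = c • (c⁻¹ • u - v) := by
      rw [smul_sub, smul_inv_smul₀ hc.ne']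
    rw [h2, inner_smul_right] at h1
    exact nonneg_of_mul_nonneg_right h1 hc

omit [CompleteSpace E] in
lemma maxMonotone_of_lipschitz {B : E → E} {χ : ℝ} (hχ : 0 < χ)
    (hBmono : ∀ x y : E, 0 ≤ ⟪x - y, B x - B y⟫)
    (hBlip : ∀ x y : E, ‖B x - B y‖ ≤ χ * ‖x - y‖) :
    MaxMonotone (fun x => ({B x} : Set E)) := by
  refine ⟨?_, ?_⟩
  · rintro x y u v rfl rfl
    exact hBmono x y
  · intro x u h
    rw [Set.mem_singleton_iff]
    set d := u - B x with hd
    set c : ℝ := 1 / (2 * χ) with hc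
    have hc0 : 0 < c := by positivity
    have h1 := h (x + c • d) _ rfl
    have e1 : x - (x + c • d) = (-c) • d := by rw [neg_smul]; abel
    have e2 : u - B (x + c • d) = d - (B (x + c • d) - B x) := by rw [hd]; abel
    rw [e1, e2, inner_smul_left, inner_sub_right, real_inner_self_eq_norm_sq] at h1
    have h2 : ⟪d, B (x + c • d) - B x⟫ ≤ ‖d‖ * (χ * (c * ‖d‖)) := by
      refine (real_inner_le_norm _ _).trans ?_
      refine mul_le_mul_of_nonneg_left ((hBlip _ _).trans_eq ?_) (norm_nonneg _)
      rw [add_sub_cancel_left, norm_smul, Real.norm_of_nonneg hc0.le]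
    have h3 : ‖d‖ * (χ * (c * ‖d‖)) = ‖d‖ ^ 2 / 2 := by
      rw [hc]; field_simp
    simp only [conj_trivial] at h1
    have h4 : ‖d‖ ^ 2 ≤ 0 := by
      have : ‖d‖ ^ 2 - ⟪d, B (x + c • d) - B x⟫ ≤ 0 := by
        by_contra! h5
        nlinarith [mul_pos hc0 h5]
      linarith
    have h5 : d = 0 := norm_eq_zero.1 (pow_eq_zero_iff two_ne_zero |>.1
      (le_antisymm h4 (sq_nonneg _)))
    exact sub_eq_zero.1 h5

omit [CompleteSpace E] in
/-- Along weakly convergent sequences in the graph of a maximally monotone operator, the limit of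
the pairings dominates the pairing of the limits; in case of equality the limit is in the graph. -/
lemma MaxMonotone.weak_limit {A : E → Set E} (hA : MaxMonotone A) {l : Filter ℕ} [l.NeBot]
    {a b : ℕ → E} {a' b' : E} {L : ℝ} (hab : ∀ n, b n ∈ A (a n))
    (ha : ∀ w, Tendsto (fun n => ⟪a n, w⟫) l (𝓝 ⟪a', w⟫))
    (hb : ∀ w, Tendsto (fun n => ⟪b n, w⟫) l (𝓝 ⟪b', w⟫))
    (hL : Tendsto (fun n => ⟪a n, b n⟫) l (𝓝 L)) :
    ⟪a', b'⟫ ≤ L ∧ (L = ⟪a', b'⟫ → b' ∈ A a') := by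
  have key : ∀ y v, v ∈ A y → ⟪a', b'⟫ - L ≤ ⟪a' - y, b' - v⟫ := by
    intro y v hv
    have h1 : Tendsto (fun n => ⟪a n - y, b n - v⟫) l
        (𝓝 (L - ⟪a', v⟫ - (⟪b', y⟫ - ⟪y, v⟫))) := by
      refine ((hL.sub (ha v)).sub ((hb y).sub_const ⟪y, v⟫)).congr fun n => ?_
      simp only [inner_sub_left, inner_sub_right, real_inner_comm (b n) y]
      ring
    have h2 := ge_of_tendsto' h1 fun n => hA.1 (hab n) hv
    simp only [inner_sub_left, inner_sub_right]
    rw [real_inner_comm b' y]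
    linarith
  refine ⟨?_, fun h => hA.2 _ _ fun y v hv => by have := key y v hv; linarith⟩
  by_contra! h
  have hmem : b' ∈ A a' := hA.2 _ _ fun y v hv => by have := key y v hv; linarith
  have := key _ _ hmem
  simp only [sub_self, inner_zero_left] at this
  linarith

lemma exists_tendsto_of_bounded (U : Ultrafilter ℕ) {f : ℕ → ℝ} {M : ℝ} (hf : ∀ n, |f n| ≤ M) :
    ∃ a, Tendsto f U (𝓝 a) := by
  obtain ⟨a, -, ha⟩ := (isCompact_Icc (a := -M) (b := M)).ultrafilter_le_nhds (U.map f)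
    (by
      rw [le_principal_iff]
      exact Filter.mem_map.2 (Filter.univ_mem' fun n => abs_le.1 (hf n)))
  exact ⟨a, ha⟩

omit [CompleteSpace E] in
lemma abs_inner_le_of_bounded {f g : ℕ → E} {M N : ℝ} (hf : ∀ n, ‖f n‖ ≤ M)
    (hg : ∀ n, ‖g n‖ ≤ N) (n : ℕ) : |⟪f n, g n⟫| ≤ M * N :=
  (abs_real_inner_le_norm _ _).trans
    (mul_le_mul (hf n) (hg n) (norm_nonneg _) ((norm_nonneg _).trans (hf n)))

/-- A bounded sequence in a Hilbert space converges weakly along every ultrafilter. -/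
lemma exists_weak_limit_of_bounded (U : Ultrafilter ℕ) {f : ℕ → E} {M : ℝ}
    (hf : ∀ n, ‖f n‖ ≤ M) :
    ∃ a : E, ∀ w, Tendsto (fun n => ⟪f n, w⟫) U (𝓝 ⟪a, w⟫) := by
  choose φ hφ using fun w : E => exists_tendsto_of_bounded U
    (abs_inner_le_of_bounded hf (g := fun _ => w) fun _ => le_rfl)
  let F : E →ₗ[ℝ] ℝ :=
    { toFun := φ
      map_add' := fun v w => tendsto_nhds_unique (hφ (v + w))
        (((hφ v).add (hφ w)).congr fun n => (inner_add_right _ _ _).symm)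
      map_smul' := fun c w => tendsto_nhds_unique (hφ (c • w))
        (((hφ w).const_mul c).congr fun n => (inner_smul_right _ _ _).symm) }
  have hF : ∀ w, ‖F w‖ ≤ M * ‖w‖ := fun w =>
    le_of_tendsto' (hφ w).norm
      (abs_inner_le_of_bounded hf (g := fun _ => w) fun _ => le_rfl)
  refine ⟨(InnerProductSpace.toDual ℝ E).symm (F.mkContinuous M hF), fun w => ?_⟩
  rw [InnerProductSpace.toDual_symm_apply]
  exact hφ w

omit [CompleteSpace E] in
lemma tendsto_inner_of_bounded_left {l : Filter ℕ} {f g : ℕ → E} {M : ℝ}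
    (hf : ∀ n, ‖f n‖ ≤ M) (hg : Tendsto g l (𝓝 0)) :
    Tendsto (fun n => ⟪f n, g n⟫) l (𝓝 0) := by
  refine squeeze_zero_norm (fun n => (norm_inner_le_norm (𝕜 := ℝ) _ _).trans
    (mul_le_mul_of_nonneg_right (hf n) (norm_nonneg _))) ?_
  simpa using hg.norm.const_mul M

omit [CompleteSpace E] in
lemma sum_smul_inner_add {ω : Fin m → ℝ} (hω1 : ∑ i, ω i = 1) (d e : E) {a v : Fin m → E}
    (ha : ∑ i, ω i • a i = 0) (hv : ∑ i, ω i • v i = 0) :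
    ∑ i, ω i * ⟪d + a i, e + v i⟫ = ⟪d, e⟫ + ∑ i, ω i * ⟪a i, v i⟫ := by
  have h1 : ∑ i, ω i * ⟪d, v i⟫ = 0 := by
    simp_rw [← inner_smul_right, ← inner_sum, hv, inner_zero_right]
  have h2 : ∑ i, ω i * ⟪a i, e⟫ = 0 := by
    simp_rw [← real_inner_smul_left, ← sum_inner, ha, inner_zero_left]
  have h3 : ∑ i, ω i * ⟪d, e⟫ = ⟪d, e⟫ := by rw [← Finset.sum_mul, hω1, one_mul]
  simp only [inner_add_left, inner_add_right, mul_add, Finset.sum_add_distrib]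
  linarith

omit [CompleteSpace E] in
lemma norm_sum_smul_sq_le {ω : Fin m → ℝ} (hω : ∀ i, 0 ≤ ω i) (hω1 : ∑ i, ω i = 1)
    (a : Fin m → E) : ‖∑ i, ω i • a i‖ ^ 2 ≤ ∑ i, ω i * ‖a i‖ ^ 2 := by
  set b := ∑ i, ω i • a i with hb
  have h0 : 0 ≤ ∑ i, ω i * ‖a i - b‖ ^ 2 :=
    Finset.sum_nonneg fun i _ => mul_nonneg (hω i) (sq_nonneg _)
  have h1 : ∑ i, ω i * ⟪a i, b⟫ = ‖b‖ ^ 2 := by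
    simp_rw [← real_inner_smul_left, ← sum_inner, ← hb, real_inner_self_eq_norm_sq]
  have h2 : ∑ i, ω i * ‖b‖ ^ 2 = ‖b‖ ^ 2 := by rw [← Finset.sum_mul, hω1, one_mul]
  have h3 : ∑ i, ω i * ‖a i - b‖ ^ 2
      = ∑ i, ω i * ‖a i‖ ^ 2 - 2 * ∑ i, ω i * ⟪a i, b⟫ + ∑ i, ω i * ‖b‖ ^ 2 := by
    rw [Finset.mul_sum, ← Finset.sum_sub_distrib, ← Finset.sum_add_distrib]
    refine Finset.sum_congr rfl fun i _ => ?_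
    rw [norm_sub_sq_real]; ring
  linarith

omit [CompleteSpace E] in
lemma norm_add_smul_sq_le {c : ℝ} (hc0 : 0 ≤ c) (hc1 : c ≤ 1) (a b : E) :
    ‖a + c • b‖ ^ 2 ≤ (1 - c) * ‖a‖ ^ 2 + c * ‖a + b‖ ^ 2 := by
  rw [norm_add_sq_real, norm_add_sq_real, inner_smul_right, norm_smul, Real.norm_eq_abs, mul_pow,
    sq_abs]
  nlinarith [mul_nonneg (mul_nonneg hc0 (sub_nonneg.2 hc1)) (sq_nonneg ‖b‖)]

omit [CompleteSpace E] in
/-- The Fejér inequality for one relaxed forward-partial inverse-forward step. -/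
lemma fejer_step {T : Fin m → E → Set E} {B : E → E} {χ γ c : ℝ} {ω : Fin m → ℝ}
    (hT : ∀ i, MonotoneSV (T i)) (hBmono : ∀ x y : E, 0 ≤ ⟪x - y, B x - B y⟫)
    (hBlip : ∀ x y : E, ‖B x - B y‖ ≤ χ * ‖x - y‖)
    (hω : ∀ i, 0 ≤ ω i) (hω1 : ∑ i, ω i = 1) (hγ : 0 ≤ γ) (hc0 : 0 ≤ c) (hc1 : c ≤ 1)
    {z p s : Fin m → E} {x q x' : E} {z' : Fin m → E}
    (hx : x = ∑ j, ω j • z j) (hp : ∀ i, z i - γ • B x - p i ∈ T i (p i))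
    (hq : q = ∑ j, ω j • p j) (hs : ∀ i, s i = (2 : ℝ) • q - p i + z i - x)
    (hx' : x' = ∑ j, ω j • z' j) (hz' : ∀ i, z' i - γ • B x' - x' ∈ T i x') :
    ∑ i, ω i * ‖z i + c • (s i - z i + γ • (B x - B q)) - z' i‖ ^ 2 ≤
      ∑ i, ω i * ‖z i - z' i‖ ^ 2
        - c * ((1 - γ ^ 2 * χ ^ 2) * ∑ i, ω i * ‖z i - s i‖ ^ 2) := by
  have hconst : ∀ d : E, ∑ i, ω i • d = d := fun d => by
    rw [← Finset.sum_smul, hω1, one_smul]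
  have hconst' : ∀ d : ℝ, ∑ i, ω i * d = d := fun d => by
    rw [← Finset.sum_mul, hω1, one_mul]
  have hxq : x - q = ∑ i, ω i • (z i - s i) := by
    have : ∀ i, z i - s i = x + p i - (2 : ℝ) • q := fun i => by rw [hs]; abel
    simp only [this, smul_sub, smul_add, Finset.sum_sub_distrib, Finset.sum_add_distrib, hconst,
      ← hq]
    rw [two_smul]; abel
  have hB : γ ^ 2 * ‖B x - B q‖ ^ 2 ≤ γ ^ 2 * χ ^ 2 * ∑ i, ω i * ‖z i - s i‖ ^ 2 := by
    have h1 := norm_sum_smul_sq_le hω hω1 (fun i => z i - s i)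
    rw [← hxq] at h1
    have h2 : ‖B x - B q‖ ^ 2 ≤ (χ * ‖x - q‖) ^ 2 :=
      pow_le_pow_left₀ (norm_nonneg _) (hBlip x q) 2
    have h3 : 0 ≤ γ ^ 2 * χ ^ 2 := by positivity
    nlinarith [mul_le_mul_of_nonneg_left h1 h3, mul_le_mul_of_nonneg_left h2 (sq_nonneg γ)]
  have hmono : 0 ≤ ∑ i, ω i * ⟪s i - z' i, z i - γ • B x - s i + γ • B q⟫ := by
    set k := x - γ • B x - q with hk
    let a : Fin m → E := fun i => p i - q
    let v : Fin m → E := fun i =>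
      (z i - γ • B x - p i) - (z' i - γ • B x' - x') - k - γ • B x'
    have ha : ∑ i, ω i • a i = 0 := by
      simp only [a, smul_sub, Finset.sum_sub_distrib, hconst, ← hq, sub_self]
    have hv : ∑ i, ω i • v i = 0 := by
      simp only [v, smul_sub (ω _), Finset.sum_sub_distrib, hconst, ← hq, ← hx, ← hx', hk]
      abel
    have h1 : ∑ i, ω i * ⟪s i - z' i, z i - γ • B x - s i + γ • B q⟫
        = ⟪q - x', k + γ • B q⟫ + ∑ i, ω i * ⟪v i, a i⟫ := by
      rw [← sum_smul_inner_add hω1 _ _ hv ha]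
      refine Finset.sum_congr rfl fun i _ => ?_
      congr 2
      · simp only [v, hk, hs, two_smul]; abel
      · simp only [a, hk, hs, two_smul]; abel
    have h2 : ∑ i, ω i * ⟪p i - x', (z i - γ • B x - p i) - (z' i - γ • B x' - x')⟫
        = ⟪q - x', k + γ • B x'⟫ + ∑ i, ω i * ⟪a i, v i⟫ := by
      rw [← sum_smul_inner_add hω1 _ _ ha hv]
      refine Finset.sum_congr rfl fun i _ => ?_
      congr 2
      · simp only [a]; abel
      · simp only [v]; abel
    have h3 : 0 ≤ ∑ i, ω i * ⟪p i - x', (z i - γ • B x - p i) - (z' i - γ • B x' - x')⟫ :=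
      Finset.sum_nonneg fun i _ => mul_nonneg (hω i) (hT i (hp i) (hz' i))
    have h4 := mul_nonneg hγ (hBmono q x')
    have h5 : ∑ i, ω i * ⟪v i, a i⟫ = ∑ i, ω i * ⟪a i, v i⟫ :=
      Finset.sum_congr rfl fun i _ => by rw [real_inner_comm]
    rw [inner_sub_right] at h4
    rw [inner_add_right, inner_smul_right] at h1 h2
    linarith
  have hid : ∀ i, ‖z i - z' i + (s i - z i + γ • (B x - B q))‖ ^ 2
      = ‖z i - z' i‖ ^ 2 - ‖z i - s i‖ ^ 2 + γ ^ 2 * ‖B x - B q‖ ^ 2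
        - 2 * ⟪s i - z' i, z i - γ • B x - s i + γ • B q⟫ := by
    intro i
    have e1 : z i - z' i + (s i - z i + γ • (B x - B q))
        = (s i - z' i) + γ • (B x - B q) := by abel
    have e2 : z i - z' i = (s i - z' i) + (z i - s i) := by abel
    have e3 : z i - γ • B x - s i + γ • B q = (z i - s i) - γ • (B x - B q) := by
      rw [smul_sub]; abel
    rw [e1, e3, e2, norm_add_sq_real (s i - z' i) (z i - s i), norm_add_sq_real,
      inner_sub_right (s i - z' i) (z i - s i), norm_smul, mul_pow, Real.norm_eq_abs, sq_abs]
    ring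
  have hsum : ∑ i, ω i * ‖z i - z' i + (s i - z i + γ • (B x - B q))‖ ^ 2
      ≤ ∑ i, ω i * ‖z i - z' i‖ ^ 2 - (1 - γ ^ 2 * χ ^ 2) * ∑ i, ω i * ‖z i - s i‖ ^ 2 := by
    have h1 : ∑ i, ω i * ‖z i - z' i + (s i - z i + γ • (B x - B q))‖ ^ 2
        = ∑ i, ω i * ‖z i - z' i‖ ^ 2 - ∑ i, ω i * ‖z i - s i‖ ^ 2 + γ ^ 2 * ‖B x - B q‖ ^ 2
        - 2 * ∑ i, ω i * ⟪s i - z' i, z i - γ • B x - s i + γ • B q⟫ := by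
      rw [← hconst' (γ ^ 2 * ‖B x - B q‖ ^ 2), Finset.mul_sum, ← Finset.sum_sub_distrib,
        ← Finset.sum_add_distrib, ← Finset.sum_sub_distrib]
      refine Finset.sum_congr rfl fun i _ => ?_
      rw [hid]; ring
    linarith
  have hrelax : ∑ i, ω i * ‖z i + c • (s i - z i + γ • (B x - B q)) - z' i‖ ^ 2
      ≤ (1 - c) * ∑ i, ω i * ‖z i - z' i‖ ^ 2
        + c * ∑ i, ω i * ‖z i - z' i + (s i - z i + γ • (B x - B q))‖ ^ 2 := by
    rw [Finset.mul_sum, Finset.mul_sum, ← Finset.sum_add_distrib]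
    refine Finset.sum_le_sum fun i _ => ?_
    have h1 := norm_add_smul_sq_le hc0 hc1 (z i - z' i) (s i - z i + γ • (B x - B q))
    rw [add_sub_right_comm]
    nlinarith [mul_le_mul_of_nonneg_left h1 (hω i)]
  nlinarith [mul_le_mul_of_nonneg_left hsum hc0]

theorem stmt11 (A : Fin m → E → Set E) (B : E → E) (χ : ℝ)
    (hA : ∀ i, MaxMonotone (A i))
    (hBmono : ∀ x y : E, 0 ≤ ⟪x - y, B x - B y⟫)
    (hBlip : ∀ x y : E, ‖B x - B y‖ ≤ χ * ‖x - y‖)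
    (hzer : ∃ x : E, (0 : E) ∈ (∑ i, A i x) + {B x})
    (ω : Fin m → ℝ) (hω : ∀ i, ω i ∈ Set.Ioc (0 : ℝ) 1) (hω1 : ∑ i, ω i = 1)
    (γ : ℝ) (hγ : γ ∈ Set.Ioo 0 (1 / χ))
    (ε : ℝ) (hε : ε ∈ Set.Ioo (0 : ℝ) 1)
    (lam : ℕ → ℝ) (hlam : ∀ n, lam n ∈ Set.Icc ε 1)
    (z r p s t : Fin m → ℕ → E) (x q : ℕ → E)
    (hx : ∀ n, x n = ∑ j, ω j • z j n)
    (hr : ∀ i n, r i n = z i n - γ • B (x n))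
    (hp : ∀ i n, r i n - p i n ∈ (γ / ω i) • A i (p i n))  -- `p i n = J_{(γ/ωᵢ)Aᵢ}(r i n)`
    (hq : ∀ n, q n = ∑ j, ω j • p j n)
    (hs : ∀ i n, s i n = (2 : ℝ) • q n - p i n + z i n - x n)
    (ht : ∀ i n, t i n = s i n - γ • B (q n))
    (hz : ∀ i n, z i (n + 1) = z i n + lam n • (t i n - r i n)) :
    ∃ xbar : E, (0 : E) ∈ (∑ i, A i xbar) + {B xbar} ∧
      (∀ w : E, Tendsto (fun n => ⟪x n, w⟫) atTop (𝓝 ⟪xbar, w⟫)) ∧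
      Tendsto (fun n => x (n + 1) - x n) atTop (𝓝 0) := by
  have hω0 : ∀ i, 0 ≤ ω i := fun i => (hω i).1.le
  have hγ0 : 0 < γ := hγ.1
  have hχ : 0 < χ := one_div_pos.1 (hγ0.trans hγ.2)
  have hγχ : 0 < 1 - γ ^ 2 * χ ^ 2 := by
    have h1 : γ * χ < 1 := (lt_div_iff₀ hχ).1 hγ.2
    nlinarith [mul_pos hγ0 hχ]
  have hconst : ∀ d : E, ∑ i, ω i • d = d := fun d => by
    rw [← Finset.sum_smul, hω1, one_smul]
  have hT : ∀ i, MaxMonotone (fun y => (γ / ω i) • A i y) := fun i =>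
    (hA i).smul (div_pos hγ0 (hω i).1)
  have hBmax := maxMonotone_of_lipschitz hχ hBmono hBlip
  have hpT : ∀ i n, z i n - γ • B (x n) - p i n ∈ (γ / ω i) • A i (p i n) := fun i n => by
    rw [← hr]; exact hp i n
  have hstep : ∀ i n, z i (n + 1)
      = z i n + lam n • (s i n - z i n + γ • (B (x n) - B (q n))) := fun i n => by
    rw [hz, ht, hr, smul_sub γ]; congr 2; abel
  let IsFixed : (Fin m → E) → Prop := fun z' =>
    ∀ i, z' i - γ • B (∑ j, ω j • z' j) - ∑ j, ω j • z' j ∈ (γ / ω i) • A i (∑ j, ω j • z' j)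
  obtain ⟨z₀, hz₀⟩ : ∃ z₀, IsFixed z₀ := by
    obtain ⟨y, hy⟩ := hzer
    obtain ⟨a, ha, b, hb, hab⟩ := Set.mem_add.1 hy
    obtain ⟨g, hg, rfl⟩ := (Set.mem_fintype_sum _ _).1 ha
    rw [Set.mem_singleton_iff] at hb
    subst hb
    have hsum : ∑ i, ω i • (y + γ • B y + (γ / ω i) • g i) = y := by
      have h1 : ∀ i, ω i • (γ / ω i) • g i = γ • g i := fun i => by
        rw [smul_smul, mul_div_cancel₀ _ (hω i).1.ne']
      simp only [smul_add (ω _), Finset.sum_add_distrib, hconst, h1, ← Finset.smul_sum]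
      rw [add_assoc, ← smul_add, add_comm (B y), hab, smul_zero, add_zero]
    refine ⟨fun i => y + γ • B y + (γ / ω i) • g i, fun i => ?_⟩
    simp only [hsum]
    have h2 : y + γ • B y + (γ / ω i) • g i - γ • B y - y = (γ / ω i) • g i := by abel
    rw [h2]
    exact Set.smul_mem_smul_set (hg i)
  -- Fejér monotonicity
  have hfejer : ∀ z', IsFixed z' → ∀ n, ∑ i, ω i * ‖z i (n + 1) - z' i‖ ^ 2 ≤
      ∑ i, ω i * ‖z i n - z' i‖ ^ 2
        - lam n * ((1 - γ ^ 2 * χ ^ 2) * ∑ i, ω i * ‖z i n - s i n‖ ^ 2) := by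
    intro z' hz' n
    simp only [hstep]
    exact fejer_step (T := fun i y => (γ / ω i) • A i y) (fun i => (hT i).1) hBmono hBlip hω0 hω1
      hγ0.le (hε.1.le.trans (hlam n).1) (hlam n).2 (hx n) (fun i => hpT i n) (hq n)
      (fun i => hs i n) rfl hz'
  have hD0 : ∀ n, 0 ≤ ∑ i, ω i * ‖z i n - s i n‖ ^ 2 := fun n =>
    Finset.sum_nonneg fun i _ => mul_nonneg (hω0 i) (sq_nonneg _)
  have hanti : ∀ z', IsFixed z' → Antitone fun n => ∑ i, ω i * ‖z i n - z' i‖ ^ 2 :=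
    fun z' hz' => antitone_nat_of_succ_le fun n => (hfejer z' hz' n).trans <|
      sub_le_self _ (mul_nonneg (hε.1.le.trans (hlam n).1) (mul_nonneg hγχ.le (hD0 n)))
  have hΦ0 : ∀ (z' : Fin m → E) n, 0 ≤ ∑ i, ω i * ‖z i n - z' i‖ ^ 2 := fun z' n =>
    Finset.sum_nonneg fun i _ => mul_nonneg (hω0 i) (sq_nonneg _)
  have hconv : ∀ z', IsFixed z' →
      ∃ a, Tendsto (fun n => ∑ i, ω i * ‖z i n - z' i‖ ^ 2) atTop (𝓝 a) := fun z' hz' =>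
    ⟨_, tendsto_atTop_ciInf (hanti z' hz') ⟨0, by rintro _ ⟨n, rfl⟩; exact hΦ0 z' n⟩⟩
  have hD : Tendsto (fun n => ∑ i, ω i * ‖z i n - s i n‖ ^ 2) atTop (𝓝 0) := by
    obtain ⟨a, ha⟩ := hconv z₀ hz₀
    have h1 := (ha.sub (ha.comp (tendsto_add_atTop_nat 1))).div_const (ε * (1 - γ ^ 2 * χ ^ 2))
    rw [sub_self, zero_div] at h1
    refine squeeze_zero hD0 (fun n => ?_) h1
    rw [le_div_iff₀ (mul_pos hε.1 hγχ)]
    have h2 := hfejer z₀ hz₀ n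
    have h3 := mul_le_mul_of_nonneg_right (hlam n).1 (mul_nonneg hγχ.le (hD0 n))
    simp only [Function.comp_apply]
    linarith
  have hzs : ∀ i, Tendsto (fun n => z i n - s i n) atTop (𝓝 0) := by
    intro i
    rw [tendsto_zero_iff_norm_tendsto_zero]
    have h1 : Tendsto (fun n => ‖z i n - s i n‖ ^ 2) atTop (𝓝 0) := by
      have h2 := hD.div_const (ω i)
      rw [zero_div] at h2
      refine squeeze_zero (fun n => sq_nonneg _) (fun n => ?_) h2
      rw [le_div_iff₀ (hω i).1, mul_comm]
      exact Finset.single_le_sum (f := fun i => ω i * ‖z i n - s i n‖ ^ 2)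
        (fun j _ => mul_nonneg (hω0 j) (sq_nonneg _)) (Finset.mem_univ i)
    simpa [Real.sqrt_sq] using h1.sqrt
  have hxq : Tendsto (fun n => x n - q n) atTop (𝓝 0) := by
    have h1 : Tendsto (fun n => ∑ i, ω i • (z i n - s i n)) atTop
        (𝓝 (∑ i : Fin m, ω i • (0 : E))) :=
      tendsto_finsetSum _ fun i _ => (hzs i).const_smul (ω i)
    simp only [smul_zero, Finset.sum_const_zero] at h1
    refine h1.congr fun n => ?_
    have h2 : ∀ i, z i n - s i n = x n + p i n - (2 : ℝ) • q n := fun i => by rw [hs]; abel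
    simp only [h2, smul_sub, smul_add, Finset.sum_sub_distrib, Finset.sum_add_distrib, hconst,
      ← hq]
    rw [two_smul]; abel
  have hpx : ∀ i, Tendsto (fun n => p i n - x n) atTop (𝓝 0) := by
    intro i
    have h1 := (hzs i).sub (hxq.const_smul (2 : ℝ))
    simp only [smul_zero, sub_zero] at h1
    refine h1.congr fun n => ?_
    rw [hs, smul_sub, two_smul ℝ (x n)]; abel
  have hBxq : Tendsto (fun n => B (x n) - B (q n)) atTop (𝓝 0) := by
    refine squeeze_zero_norm (fun n => hBlip _ _) ?_
    simpa using hxq.norm.const_mul χ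
  have hxx : Tendsto (fun n => x (n + 1) - x n) atTop (𝓝 0) := by
    have h1 : ∀ n, x (n + 1) - x n = lam n • (γ • (B (x n) - B (q n)) - (x n - q n)) := by
      intro n
      have h2 : ∀ i, s i n - z i n = (2 : ℝ) • q n - p i n - x n := fun i => by rw [hs]; abel
      rw [hx (n + 1)]
      simp only [hstep, h2, smul_add (ω _), smul_comm (ω _) (lam n), Finset.sum_add_distrib,
        ← Finset.smul_sum, ← hx, hconst, smul_sub (ω _) _ _, Finset.sum_sub_distrib, ← hq]
      rw [add_sub_cancel_left, two_smul]
      congr 1; abel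
    have h3 : Tendsto (fun n => γ • (B (x n) - B (q n)) - (x n - q n)) atTop (𝓝 0) := by
      simpa using (hBxq.const_smul γ).sub hxq
    refine squeeze_zero_norm (fun n => ?_) (tendsto_zero_iff_norm_tendsto_zero.1 h3)
    rw [h1, norm_smul, Real.norm_of_nonneg (hε.1.le.trans (hlam n).1)]
    exact mul_le_of_le_one_left (norm_nonneg _) (hlam n).2
  -- boundedness
  have hzbd : ∀ i, ∃ M, ∀ n, ‖z i n‖ ≤ M := by
    intro i
    refine ⟨√((∑ i, ω i * ‖z i 0 - z₀ i‖ ^ 2) / ω i) + ‖z₀ i‖, fun n => ?_⟩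
    have h1 : ‖z i n - z₀ i‖ ≤ √((∑ i, ω i * ‖z i 0 - z₀ i‖ ^ 2) / ω i) := by
      refine Real.le_sqrt_of_sq_le ?_
      rw [le_div_iff₀ (hω i).1, mul_comm]
      exact (Finset.single_le_sum (f := fun i => ω i * ‖z i n - z₀ i‖ ^ 2)
        (fun j _ => mul_nonneg (hω0 j) (sq_nonneg _)) (Finset.mem_univ i)).trans
          (hanti z₀ hz₀ (Nat.zero_le n))
    have h2 := norm_add_le (z i n - z₀ i) (z₀ i)
    rw [sub_add_cancel] at h2
    linarith
  choose M hM using hzbd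
  have hxbd : ∀ n, ‖x n‖ ≤ ∑ i, ω i * M i := fun n => by
    rw [hx]
    refine (norm_sum_le _ _).trans (Finset.sum_le_sum fun i _ => ?_)
    rw [norm_smul, Real.norm_of_nonneg (hω0 i)]
    exact mul_le_mul_of_nonneg_left (hM i n) (hω0 i)
  obtain ⟨Mx, hMx⟩ : ∃ Mx, ∀ n, ‖x n‖ ≤ Mx := ⟨_, hxbd⟩
  obtain ⟨MB, hMB⟩ : ∃ MB, ∀ n, ‖B (x n)‖ ≤ MB := by
    refine ⟨χ * Mx + ‖B 0‖, fun n => ?_⟩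
    have h1 := norm_add_le (B (x n) - B 0) (B 0)
    have h2 := hBlip (x n) 0
    rw [sub_add_cancel] at h1
    rw [sub_zero] at h2
    nlinarith [mul_le_mul_of_nonneg_left (hMx n) hχ.le]
  -- weak cluster points are fixed points
  have hcluster : ∀ U : Ultrafilter ℕ, (U : Filter ℕ) ≤ atTop → ∃ z', IsFixed z' ∧
      ∀ i w, Tendsto (fun n => ⟪z i n, w⟫) U (𝓝 ⟪z' i, w⟫) := by
    intro U hU
    choose z' hz' using fun i => exists_weak_limit_of_bounded U (hM i)
    refine ⟨z', ?_, hz'⟩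
    obtain ⟨c, hc⟩ := exists_weak_limit_of_bounded U hMB
    obtain ⟨κ, hκ⟩ := exists_tendsto_of_bounded U (abs_inner_le_of_bounded hMx hMB)
    obtain ⟨ξ, hξ⟩ := exists_tendsto_of_bounded U (abs_inner_le_of_bounded hMx hMx)
    choose ζ hζ using fun i => exists_tendsto_of_bounded U (abs_inner_le_of_bounded hMx (hM i))
    set x' := ∑ j, ω j • z' j with hx'
    have hxw : ∀ w, Tendsto (fun n => ⟪x n, w⟫) U (𝓝 ⟪x', w⟫) := by
      intro w
      simp only [hx, hx', sum_inner, real_inner_smul_left]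
      exact tendsto_finsetSum _ fun i _ => (hz' i w).const_mul _
    have hζξ : ∑ i, ω i * ζ i = ξ := by
      refine tendsto_nhds_unique (tendsto_finsetSum _ fun i _ => (hζ i).const_mul (ω i))
        (hξ.congr fun n => ?_)
      conv_lhs => rw [hx n, inner_sum, ← hx n]
      simp only [inner_smul_right]
    have hpx' : ∀ i w, Tendsto (fun n => ⟪p i n - x n, w⟫) U (𝓝 0) := fun i w => by
      simpa using ((hpx i).mono_left hU).inner (tendsto_const_nhds (x := w))
    have hpw : ∀ i w, Tendsto (fun n => ⟪p i n, w⟫) U (𝓝 ⟪x', w⟫) := by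
      intro i w
      have h1 := (hxw w).add (hpx' i w)
      rw [add_zero] at h1
      refine h1.congr fun n => ?_
      rw [← inner_add_left, add_sub_cancel]
    have huw : ∀ i w, Tendsto (fun n => ⟪z i n - γ • B (x n) - p i n, w⟫) U
        (𝓝 ⟪z' i - γ • c - x', w⟫) := by
      intro i w
      simp only [inner_sub_left, real_inner_smul_left]
      exact ((hz' i w).sub ((hc w).const_mul γ)).sub (hpw i w)
    have hL : ∀ i, Tendsto (fun n => ⟪p i n, z i n - γ • B (x n) - p i n⟫) U
        (𝓝 (ζ i - γ * κ - ξ)) := by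
      intro i
      have hy : ∀ n, ‖z i n - γ • B (x n) - x n‖ ≤ M i + γ * MB + Mx := fun n => by
        refine (norm_sub_le _ _).trans (add_le_add ((norm_sub_le _ _).trans
          (add_le_add (hM i n) ?_)) (hMx n))
        rw [norm_smul, Real.norm_of_nonneg hγ0.le]
        exact mul_le_mul_of_nonneg_left (hMB n) hγ0.le
      have he := (hpx i).mono_left hU
      have h1 := tendsto_inner_of_bounded_left hy he
      have h2 := tendsto_inner_of_bounded_left hMx he
      have h3 : Tendsto (fun n => ⟪p i n - x n, p i n - x n⟫) U (𝓝 0) := by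
        simpa using Filter.Tendsto.inner (𝕜 := ℝ) he he
      have h4 := (((((hζ i).sub (hκ.const_mul γ)).sub hξ).add h1).sub h2).sub h3
      simp only [add_zero, sub_zero] at h4
      refine h4.congr fun n => ?_
      have e1 : p i n = x n + (p i n - x n) := by abel
      have e2 : z i n - γ • B (x n) - p i n
          = (z i n - γ • B (x n) - x n) - (p i n - x n) := by abel
      have e3 : ⟪x n, z i n - γ • B (x n) - x n⟫
          = ⟪x n, z i n⟫ - γ * ⟪x n, B (x n)⟫ - ⟪x n, x n⟫ := by
        rw [inner_sub_right, inner_sub_right, inner_smul_right]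
      rw [e2]
      generalize z i n - γ • B (x n) - x n = y at e3 ⊢
      conv_rhs => rw [e1]
      generalize p i n - x n = e
      simp only [add_sub_cancel_left, inner_add_left, inner_sub_right, e3, real_inner_comm y e]
      ring
    have hAi := fun i => (hT i).weak_limit (hpT i) (hpw i) (huw i) (hL i)
    have hBi := hBmax.weak_limit (fun n => Set.mem_singleton (B (x n))) hxw hc hκ
    have hsumL : ∑ i, ω i * (ζ i - γ * κ - ξ) = -(γ * κ) := by
      simp only [mul_sub, Finset.sum_sub_distrib, hζξ, ← Finset.sum_mul, hω1]
      ring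
    have hsumI : ∑ i, ω i * ⟪x', z' i - γ • c - x'⟫ = -(γ * ⟪x', c⟫) := by
      simp_rw [← real_inner_smul_right, ← inner_sum]
      simp only [smul_sub (ω _), Finset.sum_sub_distrib, hconst, ← hx']
      rw [sub_right_comm, sub_self, zero_sub, inner_neg_right, inner_smul_right]
    have hle : ∀ i ∈ Finset.univ, ω i * ⟪x', z' i - γ • c - x'⟫ ≤ ω i * (ζ i - γ * κ - ξ) :=
      fun i _ => mul_le_mul_of_nonneg_left (hAi i).1 (hω0 i)
    have hκc : γ * ⟪x', c⟫ ≤ γ * κ := mul_le_mul_of_nonneg_left hBi.1 hγ0.le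
    have hsle := Finset.sum_le_sum hle
    have hκeq : κ = ⟪x', c⟫ := mul_left_cancel₀ hγ0.ne' (by linarith)
    have hcB : c = B x' := hBi.2 hκeq
    have heq := (Finset.sum_eq_sum_iff_of_le hle).1 (by linarith)
    intro i
    have h1 := (hAi i).2 (mul_left_cancel₀ (hω i).1.ne' (heq i (Finset.mem_univ i))).symm
    rw [hcB] at h1
    exact h1
  -- uniqueness of weak cluster points
  have hunique : ∀ U V : Ultrafilter ℕ, (U : Filter ℕ) ≤ atTop → (V : Filter ℕ) ≤ atTop →
      ∀ u v : Fin m → E, IsFixed u → IsFixed v →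
      (∀ i w, Tendsto (fun n => ⟪z i n, w⟫) U (𝓝 ⟪u i, w⟫)) →
      (∀ i w, Tendsto (fun n => ⟪z i n, w⟫) V (𝓝 ⟪v i, w⟫)) → u = v := by
    intro U V hU hV u v hu hv hzu hzv
    obtain ⟨a, ha⟩ := hconv u hu
    obtain ⟨b, hb⟩ := hconv v hv
    have h1 : Tendsto (fun n => ∑ i, ω i * (2 * ⟪z i n, u i - v i⟫)) atTop
        (𝓝 (b - a + (∑ i, ω i * ‖u i‖ ^ 2 - ∑ i, ω i * ‖v i‖ ^ 2))) := by
      refine ((hb.sub ha).add_const _).congr fun n => ?_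
      simp only [← Finset.sum_sub_distrib, ← Finset.sum_add_distrib]
      refine Finset.sum_congr rfl fun i _ => ?_
      rw [norm_sub_sq_real, norm_sub_sq_real, inner_sub_right]
      ring
    have h2 : Tendsto (fun n => ∑ i, ω i * (2 * ⟪z i n, u i - v i⟫)) U
        (𝓝 (∑ i, ω i * (2 * ⟪u i, u i - v i⟫))) :=
      tendsto_finsetSum _ fun i _ => ((hzu i _).const_mul 2).const_mul _
    have h3 : Tendsto (fun n => ∑ i, ω i * (2 * ⟪z i n, u i - v i⟫)) V
        (𝓝 (∑ i, ω i * (2 * ⟪v i, u i - v i⟫))) :=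
      tendsto_finsetSum _ fun i _ => ((hzv i _).const_mul 2).const_mul _
    have h4 := (tendsto_nhds_unique h2 (h1.mono_left hU)).trans
      (tendsto_nhds_unique (h1.mono_left hV) h3)
    have h5 : ∑ i, ω i * ‖u i - v i‖ ^ 2 = 0 := by
      have h6 : ∑ i, ω i * (2 * ⟪u i, u i - v i⟫) - ∑ i, ω i * (2 * ⟪v i, u i - v i⟫)
          = 2 * ∑ i, ω i * ‖u i - v i‖ ^ 2 := by
        rw [← Finset.sum_sub_distrib, Finset.mul_sum]
        refine Finset.sum_congr rfl fun i _ => ?_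
        rw [← real_inner_self_eq_norm_sq, inner_sub_left]
        ring
      linarith
    funext i
    have h7 := (Finset.sum_eq_zero_iff_of_nonneg fun i _ =>
      mul_nonneg (hω0 i) (sq_nonneg ‖u i - v i‖)).1 h5 i (Finset.mem_univ i)
    have h8 := (mul_eq_zero.1 h7).resolve_left (hω i).1.ne'
    exact sub_eq_zero.1 (norm_eq_zero.1 (pow_eq_zero_iff two_ne_zero |>.1 h8))
  obtain ⟨z', hz', hz'w⟩ := hcluster (Ultrafilter.of atTop) (Ultrafilter.of_le atTop)
  refine ⟨∑ j, ω j • z' j, ?_, fun w => ?_, hxx⟩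
  · set x' := ∑ j, ω j • z' j with hx'
    refine Set.mem_add.2 ⟨∑ i, (γ / ω i)⁻¹ • (z' i - γ • B x' - x'), ?_, B x', rfl, ?_⟩
    · exact Set.finsetSum_mem_finsetSum _ _ _ fun i _ =>
        (Set.mem_smul_set_iff_inv_smul_mem₀ (div_pos hγ0 (hω i).1).ne' _ _).1 (hz' i)
    · have h1 : ∀ i, (γ / ω i)⁻¹ • (z' i - γ • B x' - x')
          = γ⁻¹ • ω i • (z' i - γ • B x' - x') := fun i => by
        rw [smul_smul, inv_div, div_eq_inv_mul]
      simp only [h1, ← Finset.smul_sum]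
      simp only [smul_sub (ω _), Finset.sum_sub_distrib, hconst, ← hx']
      rw [sub_right_comm, sub_self, zero_sub, smul_neg, inv_smul_smul₀ hγ0.ne', neg_add_cancel]
  · rw [tendsto_iff_ultrafilter]
    intro U hU
    obtain ⟨u, hu, huw⟩ := hcluster U hU
    obtain rfl := hunique U _ hU (Ultrafilter.of_le atTop) u z' hu hz' huw hz'w
    simp only [hx, sum_inner, real_inner_smul_left]
    exact tendsto_finsetSum _ fun i _ => (huw i w).const_mul _
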